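/- arXiv:2210.02972 — 2 statements merged into one kernel-verified Lean document; each statement's English description precedes it below -/
import Mathlib

section
/- For every prime p and integer a ≥ 6, a group of order p^a has at most c(p) · p^{a²/4} subgroups, where c(p) = 2.129 · ∏_{i≥1}(1 - p^{-i})^{-1}. -/
open Finset in
/-- Subgroups of order `p ^ (m + 1)` not contained in a subgroup `M` of index `p`, all having the
same intersection of order `p ^ m` with `M`, number at most `p ^ (a - m)` where `p ^ (a + 1)` is
the order of the group. -/
theorem Subgroup.card_filter_inf_eq_le {p a m : ℕ} (hp : p.Prime) (hm : m ≤ a)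
    {P : Type*} [Group P] [Fintype P] [DecidableEq P] (M : Subgroup P)
    (hP : Nat.card P = p ^ (a + 1)) (hM : Nat.card M = p ^ a)
    (s : Finset (Subgroup P)) (K : Subgroup P) (hK : Nat.card K = p ^ m)
    (hs : ∀ H ∈ s, Nat.card H = p ^ (m + 1) ∧ H ⊓ M = K) :
    #s ≤ p ^ (a - m) := by
  classical
  let f : Subgroup P → Finset P := fun H => univ.filter (fun x => x ∈ H ∧ x ∉ M)
  have cardS : ∀ H : Subgroup P, #(univ.filter (fun x => x ∈ H)) = Nat.card H := fun H => by
    rw [Nat.card_eq_fintype_card, Fintype.card_subtype]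
  have hf : ∀ H ∈ s, #(f H) = p ^ (m + 1) - p ^ m := by
    intro H hH
    obtain ⟨h1, h2⟩ := hs H hH
    have : f H = univ.filter (fun x => x ∈ H) \ univ.filter (fun x => x ∈ K) := by
      ext x
      simp only [f, mem_filter, mem_univ, true_and, mem_sdiff, ← h2, Subgroup.mem_inf]
      tauto
    rw [this, card_sdiff_of_subset, cardS, cardS, h1, hK]
    intro x hx
    simp only [mem_filter, mem_univ, true_and, ← h2, Subgroup.mem_inf] at hx ⊢
    exact hx.1
  have hdisj : (s : Set (Subgroup P)).PairwiseDisjoint f := by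
    intro H hH H' hH' hne
    rw [Function.onFun, Finset.disjoint_left]
    intro x hx hx'
    simp only [f, mem_filter, mem_univ, true_and] at hx hx'
    obtain ⟨h1, h2⟩ := hs H hH
    obtain ⟨h1', h2'⟩ := hs H' hH'
    apply hne
    have hKle : K ≤ H ⊓ H' := le_inf (h2 ▸ inf_le_left) (h2' ▸ inf_le_left)
    have hdvd : Nat.card (H ⊓ H' : Subgroup P) ∣ p ^ (m + 1) :=
      h1 ▸ Subgroup.card_dvd_of_le inf_le_left
    obtain ⟨j, hj, hcard⟩ := (Nat.dvd_prime_pow hp).1 hdvd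
    have hlt : p ^ m < p ^ j := by
      rw [← hcard, ← hK]
      refine lt_of_le_of_ne (Subgroup.card_le_of_le hKle) fun h => ?_
      have := Subgroup.eq_of_le_of_card_ge hKle h.ge
      exact hx.2 (h2.symm ▸ this ▸ (⟨hx.1, hx'.1⟩ : x ∈ H ⊓ H') : x ∈ H ⊓ M).2
    have hj' : j = m + 1 := by
      have := (Nat.pow_lt_pow_iff_right hp.one_lt).1 hlt
      omega
    subst hj'
    have e1 := Subgroup.eq_of_le_of_card_ge (inf_le_left : H ⊓ H' ≤ H) (by rw [h1, hcard])
    have e2 := Subgroup.eq_of_le_of_card_ge (inf_le_right : H ⊓ H' ≤ H') (by rw [h1', hcard])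
    rw [← e1, e2]
  have hcount : #s * (p ^ (m + 1) - p ^ m) ≤ p ^ (a + 1) - p ^ a := by
    rw [← smul_eq_mul, ← sum_const, ← sum_congr rfl hf, ← card_biUnion hdisj]
    calc #(s.biUnion f) ≤ #(univ \ univ.filter (fun x => x ∈ M)) := by
          apply card_le_card
          intro x hx
          simp only [f, mem_biUnion, mem_filter, mem_univ, true_and, mem_sdiff] at hx ⊢
          obtain ⟨_, _, _, h⟩ := hx
          exact h
      _ = _ := by
          rw [card_sdiff_of_subset (subset_univ _), cardS, hM, card_univ,
            ← Nat.card_eq_fintype_card, hP]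
  have hpow : p ^ (a + 1) - p ^ a = p ^ (a - m) * (p ^ (m + 1) - p ^ m) := by
    rw [Nat.mul_sub, ← pow_add, ← pow_add]
    congr 2 <;> omega
  rw [hpow] at hcount
  exact Nat.le_of_mul_le_mul_right hcount
    (Nat.sub_pos_of_lt (Nat.pow_lt_pow_right hp.one_lt (Nat.lt_succ_self m)))

theorem Subgroup.card_subgroupOf_of_not_le {p a m : ℕ} (hp : p.Prime)
    {P : Type*} [Group P] [Finite P] (M H : Subgroup P)
    (hP : Nat.card P = p ^ (a + 1)) (hM : Nat.card M = p ^ a)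
    (hH : Nat.card H = p ^ (m + 1)) (hHM : ¬ H ≤ M) :
    Nat.card (H.subgroupOf M) = p ^ m ∧ Nat.card (H ⊓ M : Subgroup P) = p ^ m := by
  have hidx : M.index = p := by
    have := M.card_mul_index
    rw [hP, hM, pow_succ] at this
    exact Nat.eq_of_mul_eq_mul_left (pow_pos hp.pos a) this
  have hmul : Nat.card (M.subgroupOf H) * M.relIndex H = p ^ (m + 1) := by
    rw [← hH]; exact Subgroup.card_mul_index _
  have hle : M.relIndex H ≤ p := by
    rw [← hidx, ← Subgroup.relIndex_top_right]
    exact Subgroup.relIndex_le_of_le_right le_top (by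
      rw [Subgroup.relIndex_top_right, hidx]; exact hp.ne_zero)
  have hrel : M.relIndex H = p := by
    obtain ⟨j, -, hj⟩ := (Nat.dvd_prime_pow hp).1 (Dvd.intro_left _ hmul)
    have hj0 : j ≠ 0 := by
      rintro rfl
      exact hHM (Subgroup.relIndex_eq_one.1 (by simpa using hj))
    refine le_antisymm hle ?_
    rw [hj]
    exact Nat.le_self_pow hj0 p
  rw [hrel, pow_succ] at hmul
  have h1 : Nat.card (M.subgroupOf H) = p ^ m := Nat.eq_of_mul_eq_mul_right hp.pos hmul
  have h2 : Nat.card (H ⊓ M : Subgroup P) = p ^ m := by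
    rw [← h1, ← Subgroup.inf_subgroupOf_left]
    exact (Nat.card_congr (Subgroup.subgroupOfEquivOfLe inf_le_left).toEquiv).symm
  refine ⟨?_, h2⟩
  rw [← h2, ← Subgroup.inf_subgroupOf_right]
  exact Nat.card_congr (Subgroup.subgroupOfEquivOfLe inf_le_right).toEquiv

open Finset in
/-- A recursive bound, mirroring the Pascal rule for Gaussian binomial coefficients, on the number
of subgroups of given order in a `p`-group with a maximal subgroup `M`. -/
theorem Subgroup.card_subgroups_card_eq_pow_succ_le {p a m : ℕ} (hp : p.Prime) (hm : m ≤ a)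
    {P : Type*} [Group P] [Finite P] (M : Subgroup P)
    (hP : Nat.card P = p ^ (a + 1)) (hM : Nat.card M = p ^ a) :
    Nat.card {H : Subgroup P // Nat.card H = p ^ (m + 1)} ≤
      Nat.card {H : Subgroup M // Nat.card H = p ^ (m + 1)} +
        p ^ (a - m) * Nat.card {H : Subgroup M // Nat.card H = p ^ m} := by
  classical
  have := Fintype.ofFinite P
  have := Fintype.ofFinite (Subgroup P)
  have := Fintype.ofFinite (Subgroup M)
  simp only [Nat.card_eq_fintype_card (α := {H : Subgroup P // Nat.card H = p ^ (m + 1)}),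
    Nat.card_eq_fintype_card (α := {H : Subgroup M // Nat.card H = p ^ (m + 1)}),
    Nat.card_eq_fintype_card (α := {H : Subgroup M // Nat.card H = p ^ m}), Fintype.card_subtype]
  rw [← card_filter_add_card_filter_not (fun H : Subgroup P => H ≤ M)]
  refine add_le_add ?_ ?_
  · refine card_le_card_of_injOn (fun H => H.subgroupOf M) ?_ ?_
    · intro H hH
      simp only [coe_filter, mem_filter, mem_univ, true_and, Set.mem_ofPred_eq] at hH ⊢
      rw [← hH.1]
      exact Nat.card_congr (Subgroup.subgroupOfEquivOfLe hH.2).toEquiv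
    · intro H hH H' hH' h
      simp only [coe_filter, mem_filter, mem_univ, true_and, Set.mem_ofPred_eq] at hH hH'
      have := Subgroup.subgroupOf_inj.1 h
      rwa [inf_eq_left.2 hH.2, inf_eq_left.2 hH'.2] at this
  · refine card_le_mul_card_image_of_maps_to (f := fun H => H.subgroupOf M) ?_ _ ?_
    · intro H hH
      simp only [mem_filter, mem_univ, true_and] at hH ⊢
      exact (Subgroup.card_subgroupOf_of_not_le hp M H hP hM hH.1 hH.2).1
    · intro K hK
      simp only [mem_filter, mem_univ, true_and] at hK
      refine Subgroup.card_filter_inf_eq_le hp hm M hP hM _ (K.map M.subtype) ?_ ?_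
      · rw [← hK]
        exact Nat.card_congr (K.equivMapOfInjective _ M.subtype_injective).symm.toEquiv
      · intro H hH
        simp only [mem_filter, mem_univ, true_and] at hH
        exact ⟨hH.1.1, by rw [← hH.2, Subgroup.subgroupOf_map_subtype]⟩

open Finset in
theorem Subgroup.card_subgroups_card_eq_pow_le {p : ℕ} (hp : p.Prime) (a : ℕ) :
    ∀ (P : Type*) [Group P], Nat.card P = p ^ a → ∀ m ≤ a,
      (Nat.card {H : Subgroup P // Nat.card H = p ^ m} : ℝ) ≤
        (p : ℝ) ^ (m * (a - m)) * ∏ i ∈ range m, (1 - (p : ℝ)⁻¹ ^ (i + 1))⁻¹ := by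
  have hp1 : (1 : ℝ) < p := by exact_mod_cast hp.one_lt
  have hpos : (0 : ℝ) < p := by linarith
  have hfac : ∀ i : ℕ, 0 < 1 - (p : ℝ)⁻¹ ^ (i + 1) := fun i =>
    sub_pos.2 (pow_lt_one₀ (by positivity) (inv_lt_one_of_one_lt₀ hp1) (by omega))
  have hprod : ∀ m, 0 < ∏ i ∈ range m, (1 - (p : ℝ)⁻¹ ^ (i + 1))⁻¹ := fun m =>
    prod_pos fun i _ => inv_pos.2 (hfac i)
  have hzero : ∀ (P : Type _) [Group P] (b : ℕ), Nat.card P = p ^ b →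
      (Nat.card {H : Subgroup P // Nat.card H = p ^ 0} : ℝ) ≤
        (p : ℝ) ^ (0 * (b - 0)) * ∏ i ∈ range 0, (1 - (p : ℝ)⁻¹ ^ (i + 1))⁻¹ := by
    intro P _ b hP
    have : Finite P := Nat.finite_of_card_ne_zero (by rw [hP]; exact pow_ne_zero _ hp.ne_zero)
    simp only [zero_mul, pow_zero, range_zero, prod_empty, mul_one]
    have : Subsingleton {H : Subgroup P // Nat.card H = 1} := ⟨fun H K => Subtype.ext <| by
      rw [Subgroup.card_eq_one.1 H.2, Subgroup.card_eq_one.1 K.2]⟩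
    exact_mod_cast Finite.card_le_one_iff_subsingleton.2 this
  induction a with
  | zero =>
    intro P _ hP m hm
    obtain rfl : m = 0 := by omega
    exact hzero P 0 hP
  | succ a ih =>
    intro P _ hP m hm
    have : Finite P := Nat.finite_of_card_ne_zero (by rw [hP]; exact pow_ne_zero _ hp.ne_zero)
    cases m with
    | zero => exact hzero P _ hP
    | succ m =>
      have hma : m ≤ a := by omega
      have := Fact.mk hp
      obtain ⟨M, hM⟩ := Sylow.exists_subgroup_card_pow_prime (G := P) p (n := a)
        (by rw [hP]; exact pow_dvd_pow _ (by omega))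
      have key := Subgroup.card_subgroups_card_eq_pow_succ_le hp hma M hP hM
      have h2 := ih M hM m hma
      have keyR : (Nat.card {H : Subgroup P // Nat.card H = p ^ (m + 1)} : ℝ) ≤
          Nat.card {H : Subgroup M // Nat.card H = p ^ (m + 1)} +
            (p : ℝ) ^ (a - m) * Nat.card {H : Subgroup M // Nat.card H = p ^ m} := by
        exact_mod_cast key
      refine keyR.trans ?_
      have hC : (∏ i ∈ range m, (1 - (p : ℝ)⁻¹ ^ (i + 1))⁻¹) =
          (1 - (p : ℝ)⁻¹ ^ (m + 1)) * ∏ i ∈ range (m + 1), (1 - (p : ℝ)⁻¹ ^ (i + 1))⁻¹ := by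
        rw [prod_range_succ, mul_comm, mul_assoc, inv_mul_cancel₀ (hfac m).ne', mul_one]
      have hsub : a + 1 - (m + 1) = a - m := by omega
      rw [hsub]
      set C := ∏ i ∈ range (m + 1), (1 - (p : ℝ)⁻¹ ^ (i + 1))⁻¹ with hCdef
      have hCpos : 0 < C := hprod (m + 1)
      have second : (p : ℝ) ^ (a - m) * Nat.card {H : Subgroup M // Nat.card H = p ^ m} ≤
          (p : ℝ) ^ ((m + 1) * (a - m)) * ((1 - (p : ℝ)⁻¹ ^ (m + 1)) * C) := by
        rw [← hC, add_mul, one_mul, pow_add, mul_comm ((p : ℝ) ^ (m * (a - m))), mul_assoc]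
        exact mul_le_mul_of_nonneg_left h2 (by positivity)
      have first : (Nat.card {H : Subgroup M // Nat.card H = p ^ (m + 1)} : ℝ) ≤
          (p : ℝ) ^ ((m + 1) * (a - m)) * ((p : ℝ)⁻¹ ^ (m + 1) * C) := by
        rcases Nat.lt_or_ge m a with hlt | hge
        · refine (ih M hM (m + 1) hlt).trans_eq ?_
          have : (m + 1) * (a - m) = (m + 1) * (a - (m + 1)) + (m + 1) := by
            rw [← Nat.mul_succ]; congr 1; omega
          rw [this, pow_add, inv_pow, ← hCdef]
          field_simp
        · have : Finite M := inferInstance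
          have : IsEmpty {H : Subgroup M // Nat.card H = p ^ (m + 1)} := ⟨fun H => by
            have h := Subgroup.card_le_card_group H.1
            rw [H.2, hM] at h
            exact absurd ((Nat.pow_le_pow_iff_right hp.one_lt).1 h) (by omega)⟩
          rw [Nat.card_of_isEmpty]
          push_cast
          positivity
      calc _ ≤ _ := add_le_add first second
        _ = _ := by ring

open Finset in
theorem sum_range_pow_mul_sub_add_two (x : ℝ) (a : ℕ) :
    ∑ m ∈ range (a + 3), x ^ (m * (a + 2 - m)) =
      2 + x ^ (a + 1) * ∑ m ∈ range (a + 1), x ^ (m * (a - m)) := by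
  rw [sum_range_succ, sum_range_succ', mul_sum]
  have : ∀ m ∈ range (a + 1), x ^ ((m + 1) * (a + 2 - (m + 1))) =
      x ^ (a + 1) * x ^ (m * (a - m)) := by
    intro m hm
    obtain ⟨k, rfl⟩ := Nat.exists_eq_add_of_le (Nat.lt_succ_iff.1 (mem_range.1 hm))
    rw [← pow_add]
    congr 1
    rw [show m + k + 2 - (m + 1) = k + 1 by omega, Nat.add_sub_cancel_left]
    ring
  rw [sum_congr rfl this]
  simp
  ring

open Finset in
theorem sum_range_pow_mul_sub_even_le {x : ℝ} (hx : 2 ≤ x) (b : ℕ) :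
    ∑ m ∈ range (2 * (b + 3) + 1), x ^ (m * (2 * (b + 3) - m)) ≤
      2.129 * x ^ ((b + 3) ^ 2) - 0.02 := by
  induction b with
  | zero =>
    simp only [sum_range_succ, range_zero, sum_empty]
    norm_num
    have h5 : (2 : ℝ) ^ 5 ≤ x ^ 5 := pow_le_pow_left₀ (by norm_num) hx 5
    have h8 : 8 * x ^ 5 ≤ x ^ 8 := by
      have : (2 : ℝ) ^ 3 ≤ x ^ 3 := pow_le_pow_left₀ (by norm_num) hx 3
      nlinarith
    have h9 : 2 * x ^ 8 ≤ x ^ 9 := by nlinarith [pow_nonneg (by linarith : 0 ≤ x) 8]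
    linarith
  | succ b ih =>
    have := sum_range_pow_mul_sub_add_two x (2 * (b + 3))
    rw [show 2 * (b + 1 + 3) = 2 * (b + 3) + 2 by ring, this]
    have hpow : (128 : ℝ) ≤ x ^ (2 * (b + 3) + 1) :=
      calc (128 : ℝ) = 2 ^ 7 := by norm_num
        _ ≤ x ^ 7 := pow_le_pow_left₀ (by norm_num) hx 7
        _ ≤ _ := pow_le_pow_right₀ (by linarith) (by omega)
    have h1 := mul_le_mul_of_nonneg_left ih (by linarith : 0 ≤ x ^ (2 * (b + 3) + 1))
    have h2 : x ^ ((b + 1 + 3) ^ 2) = x ^ (2 * (b + 3) + 1) * x ^ ((b + 3) ^ 2) := by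
      rw [← pow_add]; congr 1; ring
    rw [h2]
    linarith

open Finset in
theorem sum_range_pow_mul_sub_odd_le {x y : ℝ} (hx : 2 ≤ x) (hy : 1.1892 ≤ y) (b : ℕ) :
    ∑ m ∈ range (2 * (b + 3) + 2), x ^ (m * (2 * (b + 3) + 1 - m)) ≤
      2.129 * (x ^ ((b + 3) * (b + 4)) * y) - 0.01 := by
  induction b with
  | zero =>
    simp only [sum_range_succ, range_zero, sum_empty]
    norm_num
    have h6 : (2 : ℝ) ^ 6 ≤ x ^ 6 := pow_le_pow_left₀ (by norm_num) hx 6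
    have h10 : 16 * x ^ 6 ≤ x ^ 10 := by
      have : (2 : ℝ) ^ 4 ≤ x ^ 4 := pow_le_pow_left₀ (by norm_num) hx 4
      nlinarith
    have h12 : 4 * x ^ 10 ≤ x ^ 12 := by
      have : (2 : ℝ) ^ 2 ≤ x ^ 2 := pow_le_pow_left₀ (by norm_num) hx 2
      nlinarith
    have : x ^ 12 * 1.1892 ≤ x ^ 12 * y := mul_le_mul_of_nonneg_left hy (by positivity)
    linarith
  | succ b ih =>
    have := sum_range_pow_mul_sub_add_two x (2 * (b + 3) + 1)
    rw [show 2 * (b + 1 + 3) = 2 * (b + 3) + 2 by ring]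
    rw [show 2 * (b + 3) + 2 + 2 = 2 * (b + 3) + 1 + 3 by ring,
      show 2 * (b + 3) + 2 + 1 = 2 * (b + 3) + 1 + 2 by ring, this]
    have hpow : (256 : ℝ) ≤ x ^ (2 * (b + 3) + 1 + 1) :=
      calc (256 : ℝ) = 2 ^ 8 := by norm_num
        _ ≤ x ^ 8 := pow_le_pow_left₀ (by norm_num) hx 8
        _ ≤ _ := pow_le_pow_right₀ (by linarith) (by omega)
    have h1 := mul_le_mul_of_nonneg_left ih (by linarith : 0 ≤ x ^ (2 * (b + 3) + 1 + 1))
    have h2 : x ^ ((b + 1 + 3) * (b + 1 + 4)) =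
        x ^ (2 * (b + 3) + 1 + 1) * x ^ ((b + 3) * (b + 4)) := by
      rw [← pow_add]; congr 1; ring
    rw [h2]
    linarith

open Finset in
theorem sum_range_pow_mul_sub_le {x : ℝ} (hx : 2 ≤ x) {a : ℕ} (ha : 6 ≤ a) :
    ∑ m ∈ range (a + 1), x ^ (m * (a - m)) ≤ 2.129 * x ^ ((a : ℝ) ^ 2 / 4) := by
  have hx0 : 0 < x := by linarith
  rcases Nat.even_or_odd' a with ⟨c, rfl | rfl⟩
  · obtain ⟨b, rfl⟩ := Nat.exists_eq_add_of_le' (show 3 ≤ c by omega)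
    have h := sum_range_pow_mul_sub_even_le hx b
    have e : x ^ (((2 * (b + 3) : ℕ) : ℝ) ^ 2 / 4) = x ^ ((b + 3) ^ 2) := by
      rw [← Real.rpow_natCast x]; congr 1; push_cast; ring
    rw [e]
    linarith
  · obtain ⟨b, rfl⟩ := Nat.exists_eq_add_of_le' (show 3 ≤ c by omega)
    have hy : (1.1892 : ℝ) ≤ x ^ (1 / 4 : ℝ) := by
      calc (1.1892 : ℝ) = (1.1892 ^ (4 : ℕ)) ^ (1 / 4 : ℝ) := by
            rw [← Real.rpow_natCast, ← Real.rpow_mul (by norm_num)]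
            norm_num
        _ ≤ _ := Real.rpow_le_rpow (by norm_num) (le_trans (by norm_num) hx) (by norm_num)
    have h := sum_range_pow_mul_sub_odd_le hx hy b
    have e : x ^ (((2 * (b + 3) + 1 : ℕ) : ℝ) ^ 2 / 4) =
        x ^ ((b + 3) * (b + 4)) * x ^ (1 / 4 : ℝ) := by
      rw [← Real.rpow_natCast x, ← Real.rpow_add hx0]; congr 1; push_cast; ring
    rw [e]
    linarith

open Finset in
theorem prod_range_inv_one_sub_pow_le_tprod {r : ℝ} (hr0 : 0 ≤ r) (hr1 : r < 1) (m : ℕ) :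
    ∏ i ∈ range m, (1 - r ^ (i + 1))⁻¹ ≤ ∏' i : ℕ, (1 - r ^ (i + 1))⁻¹ := by
  have hpow : ∀ i : ℕ, r ^ (i + 1) ≤ r := fun i => pow_le_of_le_one hr0 hr1.le (by omega)
  have hfac : ∀ i : ℕ, 0 < 1 - r ^ (i + 1) := fun i => by linarith [hpow i]
  have hone : ∀ i : ℕ, 1 ≤ (1 - r ^ (i + 1))⁻¹ := fun i =>
    (one_le_inv₀ (hfac i)).2 (by linarith [pow_nonneg hr0 (i + 1)])
  have hsum : Summable fun i : ℕ => r ^ (i + 1) / (1 - r ^ (i + 1)) := by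
    refine Summable.of_nonneg_of_le (f := fun i : ℕ => r ^ i * (r / (1 - r)))
      (fun i => div_nonneg (by positivity) (hfac i).le) (fun i => ?_)
      ((summable_geometric_of_lt_one hr0 hr1).mul_right _)
    rw [pow_succ, ← mul_div_assoc]
    exact div_le_div_of_nonneg_left (by positivity) (by linarith) (by
      have := hpow i; rw [pow_succ] at this; linarith)
  have hmul : Multipliable fun i : ℕ => (1 - r ^ (i + 1))⁻¹ := by
    have := Real.multipliable_one_add_of_summable hsum
    refine this.congr fun i => ?_
    have := (hfac i).ne'
    field_simp
    ring
  refine ge_of_tendsto hmul.hasProd.tendsto_prod_nat ?_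
  filter_upwards [Filter.eventually_ge_atTop m] with n hn
  exact prod_le_prod_of_subset_of_one_le (range_mono hn) (fun i _ => (inv_pos.2 (hfac i)).le)
    (fun i _ _ => hone i)

open Finset in
theorem subgroups_of_p_group_large (p : ℕ) (hp : p.Prime) (a : ℕ) (ha : 6 ≤ a)
    (P : Type*) [Group P] (hP : Nat.card P = p ^ a) :
    (Nat.card (Subgroup P) : ℝ) ≤
      2.129 * (∏' i : ℕ, (1 - ((p : ℝ))⁻¹ ^ (i + 1))⁻¹) *
        (p : ℝ) ^ ((a : ℝ) ^ 2 / 4) := by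
  classical
  have hp2 : (2 : ℝ) ≤ p := by exact_mod_cast hp.two_le
  have : Finite P := Nat.finite_of_card_ne_zero (by rw [hP]; exact pow_ne_zero _ hp.ne_zero)
  have := Fintype.ofFinite (Subgroup P)
  have hr0 : 0 ≤ (p : ℝ)⁻¹ := by positivity
  have hr1 : (p : ℝ)⁻¹ < 1 := inv_lt_one_of_one_lt₀ (by linarith)
  set C := ∏' i : ℕ, (1 - ((p : ℝ))⁻¹ ^ (i + 1))⁻¹ with hC
  have hC0 : 0 ≤ C := by
    have := prod_range_inv_one_sub_pow_le_tprod hr0 hr1 0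
    rw [range_zero, prod_empty] at this
    linarith
  have hsplit : Nat.card (Subgroup P) ≤
      ∑ m ∈ range (a + 1), Nat.card {H : Subgroup P // Nat.card H = p ^ m} := by
    have hcover : (univ : Finset (Subgroup P)) ⊆
        (range (a + 1)).biUnion fun m => univ.filter fun H => Nat.card H = p ^ m := by
      intro H _
      obtain ⟨j, hj, hcard⟩ := (Nat.dvd_prime_pow hp).1 (hP ▸ H.card_subgroup_dvd_card)
      simp only [mem_biUnion, mem_range, mem_filter, mem_univ, true_and]
      exact ⟨j, by omega, hcard⟩
    rw [Nat.card_eq_fintype_card, ← card_univ]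
    refine (card_le_card hcover).trans (card_biUnion_le.trans_eq ?_)
    refine sum_congr rfl fun m _ => ?_
    rw [Nat.card_eq_fintype_card (α := {H : Subgroup P // Nat.card H = p ^ m}),
      Fintype.card_subtype]
  calc (Nat.card (Subgroup P) : ℝ)
      ≤ ∑ m ∈ range (a + 1), (Nat.card {H : Subgroup P // Nat.card H = p ^ m} : ℝ) := by
        exact_mod_cast hsplit
    _ ≤ ∑ m ∈ range (a + 1), (p : ℝ) ^ (m * (a - m)) * C := by
        refine sum_le_sum fun m hm => ?_
        refine (Subgroup.card_subgroups_card_eq_pow_le hp a P hP m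
          (Nat.lt_succ_iff.1 (mem_range.1 hm))).trans ?_
        exact mul_le_mul_of_nonneg_left (prod_range_inv_one_sub_pow_le_tprod hr0 hr1 m)
          (by positivity)
    _ ≤ (2.129 * (p : ℝ) ^ ((a : ℝ) ^ 2 / 4)) * C := by
        rw [← sum_mul]
        exact mul_le_mul_of_nonneg_right (sum_range_pow_mul_sub_le hp2 ha) hC0
    _ = _ := by ring
end

section
/- Every finite non-trivial group R has at most 7.3722 · |R|^{(log₂|R|)/4 + 1.5315} subgroups. -/
theorem sub_sum_logb_primes_le {s T : Finset ℕ} {c : ℝ} (hs : ∀ p ∈ s, p.Prime)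
    (hT : ∀ p ∈ T, Real.logb 2 p ≤ c) (hc : ∀ p : ℕ, p.Prime → p ∉ T → c ≤ Real.logb 2 p) :
    c * s.card - ∑ p ∈ s, Real.logb 2 p ≤ ∑ p ∈ T, (c - Real.logb 2 p) := by
  have h₁ : c * s.card - ∑ p ∈ s, Real.logb 2 p = ∑ p ∈ s, (c - Real.logb 2 p) := by
    rw [Finset.sum_sub_distrib, Finset.sum_const, nsmul_eq_mul, mul_comm]
  have h₂ : ∑ p ∈ s, (c - Real.logb 2 p) ≤ ∑ p ∈ s ∩ T, (c - Real.logb 2 p) := by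
    rw [← Finset.sum_inter_add_sum_sdiff s T]
    have : ∑ p ∈ s \ T, (c - Real.logb 2 p) ≤ 0 := Finset.sum_nonpos fun p hp => by
      rw [Finset.mem_sdiff] at hp
      linarith [hc p (hs p hp.1) hp.2]
    linarith
  rw [h₁]
  refine h₂.trans (Finset.sum_le_sum_of_subset_of_nonneg Finset.inter_subset_right ?_)
  intro p hp _
  linarith [hT p hp]

theorem le_logb_two_of_two_pow_le {k m : ℕ} (h : 2 ^ k ≤ m) : (k : ℝ) ≤ Real.logb 2 m := by
  have : (2 : ℝ) ^ k ≤ m := by exact_mod_cast h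
  rw [Real.le_logb_iff_rpow_le (by norm_num) (lt_of_lt_of_le (by positivity) this),
    Real.rpow_natCast]
  exact this

theorem logb_two_le_of_le_two_pow {k m : ℕ} (hm : 0 < m) (h : m ≤ 2 ^ k) :
    Real.logb 2 m ≤ k := by
  rw [Real.logb_le_iff_le_rpow (by norm_num) (by exact_mod_cast hm), Real.rpow_natCast]
  exact_mod_cast h

theorem two_mul_card_sub_le_sum_logb {s : Finset ℕ} (hs : ∀ p ∈ s, p.Prime) :
    2 * (s.card : ℝ) - 1.42 ≤ ∑ p ∈ s, Real.logb 2 p := by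
  have h := sub_sum_logb_primes_le (T := {2, 3}) (c := 2) hs
    (fun p hp => by
      have : 0 < p ∧ p ≤ 4 := by simp at hp; omega
      simpa using logb_two_le_of_le_two_pow (k := 2) this.1 this.2)
    (fun p hp hpT => by
      have : 4 ≤ p := by
        by_contra! hlt
        interval_cases p <;> simp_all +decide
      simpa using le_logb_two_of_two_pow_le (k := 2) this)
  have h3 : 1.58 ≤ Real.logb 2 3 := by
    have := le_logb_two_of_two_pow_le (k := 79) (m := 3 ^ 50) (by norm_num)
    rw [Nat.cast_pow, Real.logb_pow] at this
    push_cast at this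
    linarith
  rw [Finset.sum_pair (by norm_num)] at h
  push_cast at h
  rw [Real.logb_self_eq_one (by norm_num)] at h
  linarith

set_option exponentiation.threshold 2000 in
theorem four_mul_card_sub_le_sum_logb {s : Finset ℕ} (hs : ∀ p ∈ s, p.Prime) :
    4 * (s.card : ℝ) - 9.126 ≤ ∑ p ∈ s, Real.logb 2 p := by
  have h := sub_sum_logb_primes_le (T := {2, 3, 5, 7, 11, 13}) (c := 4) hs
    (fun p hp => by
      have : 0 < p ∧ p ≤ 16 := by simp at hp; omega
      simpa using logb_two_le_of_le_two_pow (k := 4) this.1 this.2)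
    (fun p hp hpT => by
      have : 16 ≤ p := by
        by_contra! hlt
        interval_cases p <;> simp_all +decide
      simpa using le_logb_two_of_two_pow_le (k := 4) this)
  have h3 : 14.874 ≤ ∑ p ∈ ({2, 3, 5, 7, 11, 13} : Finset ℕ), Real.logb 2 p := by
    rw [← Real.logb_prod _ _ (fun p hp => by simp at hp; norm_cast; omega)]
    have := le_logb_two_of_two_pow_le (k := 1889) (m := 30030 ^ 127) (by norm_num)
    rw [Nat.cast_pow, Real.logb_pow] at this
    push_cast at this
    norm_num
    linarith
  rw [Finset.sum_sub_distrib] at h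
  norm_num at h h3 ⊢
  linarith

theorem sum_logb_bound {s : Finset ℕ} (hs : ∀ p ∈ s, p.Prime) (b : ℕ → ℝ) (hb : ∀ p, 0 ≤ b p)
    {L : ℝ} (hL : L = ∑ p ∈ s, (b p + 1) * Real.logb 2 p) :
    ∑ p ∈ s, (L - (b p + 1) * Real.logb 2 p + (b p + 1)
      + b p * (b p + 3) / 4 * Real.logb 2 p) ≤ L ^ 2 / 4 + 1.5315 * L + 2.5 := by
  have h2 := two_mul_card_sub_le_sum_logb hs
  have h4 := four_mul_card_sub_le_sum_logb hs
  have hl : ∀ p ∈ s, 1 ≤ Real.logb 2 p := fun p hp => by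
    simpa using le_logb_two_of_two_pow_le (k := 1) (by simpa using (hs p hp).two_le)
  set k : ℝ := (s.card : ℝ) with hk
  set P := ∑ p ∈ s, Real.logb 2 p with hP
  have hP0 : 0 ≤ P := Finset.sum_nonneg fun p hp => by linarith [hl p hp]
  set X := ∑ p ∈ s, b p * Real.logb 2 p with hX
  have hLX : L = P + X := by
    rw [hL, hP, hX, ← Finset.sum_add_distrib]
    exact Finset.sum_congr rfl fun p _ => by ring
  have hW : ∑ p ∈ s, (b p * Real.logb 2 p) ^ 2 ≤ X ^ 2 :=
    Finset.sum_sq_le_sq_sum_of_nonneg fun p hp => mul_nonneg (hb p) (by linarith [hl p hp])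
  have hterm : ∀ p ∈ s, b p + b p * (b p + 3) / 4 * Real.logb 2 p
      ≤ (P / 2 + 2.5315 - k) * (b p * Real.logb 2 p) + (b p * Real.logb 2 p) ^ 2 / 4 := by
    intro p hp
    have h1 := hl p hp
    have hbp := hb p
    set l := Real.logb 2 p
    have : 0 ≤ b p * ((P / 2 + 2.5315 - k - 1.8) * l + (1.05 * l - 1)
        + b p * l * (l - 1) / 4) := by
      refine mul_nonneg hbp (add_nonneg (add_nonneg (mul_nonneg ?_ ?_) ?_) ?_)
      · linarith
      · linarith
      · linarith
      · have := mul_nonneg (mul_nonneg hbp (by linarith : 0 ≤ l)) (by linarith : 0 ≤ l - 1)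
        linarith
    linarith
  have hsum := Finset.sum_le_sum hterm
  rw [Finset.sum_add_distrib (f := fun p => (P / 2 + 2.5315 - k) * (b p * Real.logb 2 p)),
    ← Finset.mul_sum, ← Finset.sum_div, ← hX] at hsum
  have hlhs : ∑ p ∈ s, (L - (b p + 1) * Real.logb 2 p + (b p + 1)
      + b p * (b p + 3) / 4 * Real.logb 2 p) =
      k * L - L + k + ∑ p ∈ s, (b p + b p * (b p + 3) / 4 * Real.logb 2 p) := by
    nth_rewrite 3 [hL]
    simp only [Finset.sum_add_distrib, Finset.sum_sub_distrib, Finset.sum_const, nsmul_eq_mul,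
      ← hk]
    ring
  have hsq : 0 ≤ P * (P / 4 + 2.2815 - k) := mul_nonneg hP0 (by linarith)
  rw [hlhs, hLX]
  nlinarith

theorem Subgroup.eq_of_lt_of_le_of_card_pow {G : Type*} [Group G] [Finite G] {p k : ℕ}
    (hp : p.Prime) {K J H : Subgroup G} (hK : Nat.card K = p ^ k) (hH : Nat.card H = p ^ (k + 1))
    (hKJ : K < J) (hJH : J ≤ H) : J = H := by
  refine Subgroup.eq_of_le_of_card_ge hJH ?_
  obtain ⟨m, -, hm⟩ := (Nat.dvd_prime_pow hp).1 (hH ▸ Subgroup.card_dvd_of_le hJH)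
  have hlt : Nat.card K < Nat.card J := by
    by_contra! hle
    exact hKJ.ne (Subgroup.eq_of_le_of_card_ge hKJ.le hle)
  rw [hK, hm] at hlt
  rw [hH, hm]
  exact Nat.pow_le_pow_right hp.pos ((Nat.pow_lt_pow_iff_right hp.one_lt).1 hlt)

theorem Subgroup.card_inf_of_index_prime {G : Type*} [Group G] [Finite G] {p k : ℕ}
    (hp : p.Prime) {M H : Subgroup G} [M.Normal] (hM : M.index = p)
    (hH : Nat.card H = p ^ (k + 1)) (hHM : ¬ H ≤ M) : Nat.card ↥(H ⊓ M) = p ^ k := by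
  have hrel : M.relIndex H = p := by
    rcases (Nat.dvd_prime hp).1 (hM ▸ Subgroup.relIndex_dvd_index_of_normal M H) with h | h
    · exact absurd (Subgroup.relIndex_eq_one.1 h) hHM
    · exact h
  have h := Subgroup.card_mul_index (M.subgroupOf H)
  have hc : Nat.card (M.subgroupOf H) = Nat.card ↥(H ⊓ M) := by
    rw [← Subgroup.inf_subgroupOf_left]
    exact Nat.card_congr (Subgroup.subgroupOfEquivOfLe inf_le_left).toEquiv
  rw [hc, show (M.subgroupOf H).index = p from hrel, hH, pow_succ] at h
  exact Nat.eq_of_mul_eq_mul_right hp.pos h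

theorem Subgroup.exists_mul_mem_of_index_prime {G : Type*} [Group G] {p : ℕ}
    (hp : p.Prime) {M H : Subgroup G} [M.Normal] (hM : M.index = p) (hHM : ¬ H ≤ M) (g : G) :
    ∃ m ∈ M, g * m ∈ H := by
  have htop : H.map (QuotientGroup.mk' M) = ⊤ := by
    have : Fact (Nat.card (G ⧸ M)).Prime := ⟨by rw [← Subgroup.index_eq_card, hM]; exact hp⟩
    refine (Subgroup.eq_bot_or_eq_top_of_prime_card _).resolve_left fun h => hHM ?_
    rwa [Subgroup.map_eq_bot_iff, QuotientGroup.ker_mk'] at h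
  obtain ⟨x, hx, hxg⟩ : QuotientGroup.mk' M g ∈ H.map (QuotientGroup.mk' M) := htop ▸ trivial
  exact ⟨g⁻¹ * x, QuotientGroup.eq.1 hxg.symm, by simpa using hx⟩

theorem card_subgroups_card_pow_succ_le {G : Type*} [Group G] [Finite G] {p k : ℕ}
    (hp : p.Prime) {M : Subgroup G} [M.Normal] (hM : M.index = p) :
    Nat.card {H : Subgroup G // Nat.card H = p ^ (k + 1)} ≤
      Nat.card {H : Subgroup M // Nat.card H = p ^ (k + 1)} +
        Nat.card {H : Subgroup M // Nat.card H = p ^ k} * (Nat.card M / p ^ k) := by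
  classical
  have := Fintype.ofFinite {H : Subgroup M // Nat.card H = p ^ k}
  obtain ⟨g, hg⟩ : ∃ g, g ∉ M := by
    by_contra! h
    rw [(Subgroup.eq_top_iff' M).2 h, Subgroup.index_top] at hM
    exact hp.one_lt.ne hM
  have hcard : Nat.card ({H : Subgroup M // Nat.card H = p ^ (k + 1)} ⊕
      (Σ K : {H : Subgroup M // Nat.card H = p ^ k}, M ⧸ K.1)) =
      Nat.card {H : Subgroup M // Nat.card H = p ^ (k + 1)} +
        Nat.card {H : Subgroup M // Nat.card H = p ^ k} * (Nat.card M / p ^ k) := by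
    rw [Nat.card_sum, Nat.card_sigma, Finset.sum_congr rfl (g := fun _ => Nat.card M / p ^ k),
      Finset.sum_const, Finset.card_univ, smul_eq_mul,
      Nat.card_eq_fintype_card (α := {H : Subgroup M // Nat.card H = p ^ k})]
    intro K _
    rw [Subgroup.card_eq_card_quotient_mul_card_subgroup K.1, K.2,
      Nat.mul_div_cancel _ (pow_pos hp.pos k)]
  have hsub : ∀ H : Subgroup G, Nat.card (H.subgroupOf M) = Nat.card ↥(H ⊓ M) := fun H => by
    rw [← Subgroup.inf_subgroupOf_right]
    exact Nat.card_congr (Subgroup.subgroupOfEquivOfLe inf_le_right).toEquiv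
  rw [← hcard]
  choose m hm hgm using fun (H : Subgroup G) (h : ¬ H ≤ M) =>
    Subgroup.exists_mul_mem_of_index_prime hp hM h g
  let f : {H : Subgroup G // Nat.card H = p ^ (k + 1)} →
      {H : Subgroup M // Nat.card H = p ^ (k + 1)} ⊕
      (Σ K : {H : Subgroup M // Nat.card H = p ^ k}, M ⧸ K.1) := fun H =>
    if h : H.1 ≤ M then
      Sum.inl ⟨H.1.subgroupOf M, by rw [hsub, inf_eq_left.2 h, H.2]⟩
    else
      Sum.inr ⟨⟨H.1.subgroupOf M, by rw [hsub, Subgroup.card_inf_of_index_prime hp hM H.2 h]⟩,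
        ((⟨m H.1 h, hm H.1 h⟩ : M) : M ⧸ H.1.subgroupOf M)⟩
  refine Nat.card_le_card_of_injective f ?_
  rintro ⟨H₁, h₁⟩ ⟨H₂, h₂⟩ heq
  rw [Subtype.mk.injEq]
  by_cases hH₁ : H₁ ≤ M <;> by_cases hH₂ : H₂ ≤ M
  · simp only [f, hH₁, hH₂, dite_true, Sum.inl.injEq, Subtype.mk.injEq,
      Subgroup.subgroupOf_inj] at heq
    rwa [inf_eq_left.2 hH₁, inf_eq_left.2 hH₂] at heq
  · simp [f, hH₁, hH₂] at heq
  · simp [f, hH₁, hH₂] at heq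
  · simp only [f, hH₁, hH₂, dite_false, Sum.inr.injEq, Sigma.mk.injEq, Subtype.mk.injEq] at heq
    obtain ⟨hK, hcoset⟩ := heq
    have hinf : H₁ ⊓ M = H₂ ⊓ M := Subgroup.subgroupOf_inj.1 hK
    have hmem : g * m H₁ hH₁ ∈ H₂ := by
      have hq : ((⟨m H₁ hH₁, hm H₁ hH₁⟩ : M) : M ⧸ H₂.subgroupOf M) =
          (⟨m H₂ hH₂, hm H₂ hH₂⟩ : M) := by
        generalize H₁.subgroupOf M = K₁ at hK hcoset
        subst hK
        exact eq_of_heq hcoset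
      have := Subgroup.mem_subgroupOf.1 (QuotientGroup.eq.1 hq.symm)
      simpa [mul_assoc] using H₂.mul_mem (hgm H₂ hH₂) this
    have hlt : H₁ ⊓ M < H₁ ⊓ H₂ := by
      refine SetLike.lt_iff_le_and_exists.2
        ⟨le_inf inf_le_left (hinf ▸ inf_le_left), g * m H₁ hH₁, ⟨hgm H₁ hH₁, hmem⟩, ?_⟩
      exact fun h => hg ((Subgroup.mul_mem_cancel_right M (hm H₁ hH₁)).1 h.2)
    have hK₁ := Subgroup.card_inf_of_index_prime hp hM h₁ hH₁
    rw [← Subgroup.eq_of_lt_of_le_of_card_pow hp hK₁ h₁ hlt inf_le_left]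
    exact Subgroup.eq_of_lt_of_le_of_card_pow hp hK₁ h₂ hlt inf_le_right

theorem card_subgroups_card_pow_le {p : ℕ} (hp : p.Prime) (a : ℕ) :
    ∀ {G : Type*} [Group G] [Finite G] (_ : Nat.card G = p ^ a) (k : ℕ),
      Nat.card {H : Subgroup G // Nat.card H = p ^ k} ≤ a.choose k * p ^ (k * (a - k)) := by
  have : Fact p.Prime := ⟨hp⟩
  induction a with
  | zero =>
    intro G _ _ hG k
    have : Subsingleton G := (Nat.card_eq_one_iff_unique.1 (by simpa using hG)).1
    cases k with
    | zero => simp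
    | succ k =>
      have : IsEmpty {H : Subgroup G // Nat.card H = p ^ (k + 1)} := ⟨fun H => by
        have := H.2
        rw [Nat.card_of_subsingleton (1 : H.1)] at this
        exact (Nat.one_lt_pow (Nat.succ_ne_zero k) hp.one_lt).ne this⟩
      rw [Nat.card_of_isEmpty]
      exact Nat.zero_le _
  | succ a ih =>
    intro G _ _ hG k
    cases k with
    | zero =>
      have : Subsingleton {H : Subgroup G // Nat.card H = p ^ 0} := ⟨fun H K => Subtype.ext <| by
        rw [Subgroup.eq_bot_of_card_eq H.1 (by simpa using H.2),
          Subgroup.eq_bot_of_card_eq K.1 (by simpa using K.2)]⟩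
      simp
    | succ k =>
      obtain ⟨M, hMc⟩ := Sylow.exists_subgroup_card_pow_prime (G := G) p (n := a)
        (hG ▸ pow_dvd_pow p a.le_succ)
      have hM : M.index = p := by
        have h := M.card_mul_index
        rw [hMc, hG, pow_succ] at h
        exact Nat.eq_of_mul_eq_mul_left (pow_pos hp.pos a) h
      have : M.Normal := Subgroup.normal_of_index_eq_minFac_card
        (by rw [hM, hG, hp.pow_minFac (Nat.succ_ne_zero a)])
      refine (card_subgroups_card_pow_succ_le hp hM).trans ?_
      have h₁ := ih hMc (k + 1)
      have h₂ := ih hMc k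
      rcases le_or_gt k a with hk | hk
      · rw [hMc, Nat.pow_div hk hp.pos, Nat.choose_succ_succ, add_comm (a.choose k), add_mul,
          Nat.add_sub_add_right]
        refine add_le_add (h₁.trans ?_) ((Nat.mul_le_mul_right _ h₂).trans ?_)
        · gcongr
          · exact hp.one_le
          · omega
        · rw [mul_assoc, ← pow_add, add_mul, one_mul]
      · rw [Nat.choose_eq_zero_of_lt (by omega), zero_mul] at h₁ h₂
        simp [Nat.le_zero.1 h₁, Nat.le_zero.1 h₂]

theorem card_subgroups_le_of_card_eq_prime_pow {p a : ℕ} (hp : p.Prime) {G : Type*} [Group G]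
    [Finite G] (hG : Nat.card G = p ^ a) :
    Nat.card (Subgroup G) ≤ 2 ^ a * p ^ (a ^ 2 / 4) := by
  have h : ∀ H : Subgroup G, ∃ k : Fin (a + 1), Nat.card H = p ^ (k : ℕ) := fun H => by
    obtain ⟨k, hk, hH⟩ := (Nat.dvd_prime_pow hp).1 (hG ▸ Subgroup.card_subgroup_dvd_card H)
    exact ⟨⟨k, by omega⟩, hH⟩
  choose e he using h
  let f : Subgroup G → Σ k : Fin (a + 1), {H : Subgroup G // Nat.card H = p ^ (k : ℕ)} :=
    fun H => ⟨e H, H, he H⟩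
  have hf : Function.Injective f := Function.LeftInverse.injective (g := fun x => x.2.1)
    fun _ => rfl
  refine (Nat.card_le_card_of_injective f hf).trans ?_
  rw [Nat.card_sigma, ← Nat.sum_range_choose, Finset.sum_mul,
    ← Fin.sum_univ_eq_sum_range (fun k => a.choose k * p ^ (a ^ 2 / 4))]
  refine Finset.sum_le_sum fun k _ => (card_subgroups_card_pow_le hp a hG k).trans ?_
  gcongr
  · exact hp.one_le
  · rw [Nat.le_div_iff_mul_le (by norm_num)]
    obtain ⟨c, hc⟩ := Nat.exists_eq_add_of_le (Nat.lt_succ_iff.1 k.2)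
    rw [show a - k = c by omega]
    nlinarith [sq_nonneg ((k : ℤ) - c)]

theorem card_isPGroup_subgroups_le {G : Type*} [Group G] [Finite G] {p : ℕ} (hp : p.Prime) :
    Nat.card {Q : Subgroup G // IsPGroup p Q} ≤
      Nat.card G / p ^ (Nat.card G).factorization p *
        (2 ^ (Nat.card G).factorization p * p ^ ((Nat.card G).factorization p ^ 2 / 4)) := by
  have : Fact p.Prime := ⟨hp⟩
  have := Fintype.ofFinite (Sylow p G)
  choose P hP using fun Q : {Q : Subgroup G // IsPGroup p Q} => Q.2.exists_le_sylow
  let f : {Q : Subgroup G // IsPGroup p Q} → Σ P : Sylow p G, Subgroup P :=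
    fun Q => ⟨P Q, Q.1.subgroupOf (P Q)⟩
  have hf : Function.Injective f :=
    Function.Injective.of_comp (f := fun x : Σ P : Sylow p G, Subgroup P =>
      x.2.map (x.1 : Subgroup G).subtype) fun Q Q' h => Subtype.ext <| by
        simpa [f, Subgroup.map_subgroupOf_eq_of_le, hP] using h
  refine (Nat.card_le_card_of_injective f hf).trans ?_
  rw [Nat.card_sigma]
  refine (Finset.sum_le_card_nsmul _ _ _ fun P _ =>
    card_subgroups_le_of_card_eq_prime_pow hp P.card_eq_multiplicity).trans ?_
  rw [smul_eq_mul, Finset.card_univ, ← Nat.card_eq_fintype_card]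
  refine Nat.mul_le_mul_right _ ?_
  let P : Sylow p G := default
  have hidx : (P : Subgroup G).index = Nat.card G / p ^ (Nat.card G).factorization p := by
    rw [← P.card_eq_multiplicity, ← (P : Subgroup G).card_mul_index,
      Nat.mul_div_cancel_left _ Nat.card_pos]
  rw [← hidx]
  exact Nat.le_of_dvd (Nat.pos_of_ne_zero Subgroup.FiniteIndex.index_ne_zero) P.card_dvd_index

theorem Subgroup.le_of_sylow_map_le {G : Type*} [Group G] [Finite G] {H K : Subgroup G}
    (h : ∀ p ∈ (Nat.card G).primeFactors, ∃ P : Sylow p H, P.map H.subtype ≤ K) : H ≤ K := by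
  rw [← inf_eq_left]
  refine Subgroup.eq_of_le_of_card_ge inf_le_left (Nat.le_of_dvd Nat.card_pos ?_)
  rw [← Nat.factorization_prime_le_iff_dvd Nat.card_pos.ne' Nat.card_pos.ne']
  intro p hp
  have : Fact p.Prime := ⟨hp⟩
  by_cases hpG : p ∈ (Nat.card G).primeFactors
  · obtain ⟨P, hP⟩ := h p hpG
    rw [← hp.pow_dvd_iff_le_factorization Nat.card_pos.ne', ← P.card_eq_multiplicity,
      Nat.card_congr (P.1.equivMapOfInjective H.subtype H.subtype_injective).toEquiv]
    exact Subgroup.card_dvd_of_le (le_inf (Subgroup.map_subtype_le _) hP)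
  · have : ¬ p ∣ Nat.card H := fun hd => hpG (Nat.mem_primeFactors.2
      ⟨hp, hd.trans (Subgroup.card_subgroup_dvd_card H), Nat.card_pos.ne'⟩)
    rw [Nat.factorization_eq_zero_of_not_dvd this]
    exact Nat.zero_le _

theorem card_subgroups_le_prod (G : Type*) [Group G] [Finite G] :
    Nat.card (Subgroup G) ≤
      ∏ p ∈ (Nat.card G).primeFactors, Nat.card {Q : Subgroup G // IsPGroup p Q} := by
  rw [← Finset.prod_coe_sort, ← Nat.card_pi]
  let f : Subgroup G → ∀ p : (Nat.card G).primeFactors, {Q : Subgroup G // IsPGroup p Q} :=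
    fun H p => ⟨(default : Sylow p H).map H.subtype, (default : Sylow p H).2.map _⟩
  refine Nat.card_le_card_of_injective f fun H K hHK => ?_
  have key : ∀ p : (Nat.card G).primeFactors, (default : Sylow p H).map H.subtype =
      (default : Sylow p K).map K.subtype := fun p => congrArg Subtype.val (congrFun hHK p)
  exact le_antisymm
    (Subgroup.le_of_sylow_map_le fun p hp =>
      ⟨default, (key ⟨p, hp⟩).le.trans (Subgroup.map_subtype_le _)⟩)
    (Subgroup.le_of_sylow_map_le fun p hp =>
      ⟨default, (key ⟨p, hp⟩).ge.trans (Subgroup.map_subtype_le _)⟩)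

theorem main_subgroup_bound (R : Type*) [Group R] [Finite R]
    (h : Nat.card R ≠ 1) :
    (Nat.card (Subgroup R) : ℝ) ≤
      7.3722 * (Nat.card R : ℝ) ^
        (Real.logb 2 (Nat.card R) / 4 + 1.5315) := by
  set n := Nat.card R with hn
  have hn0 : n ≠ 0 := Nat.card_pos.ne'
  have hnR : (0 : ℝ) < n := by exact_mod_cast Nat.pos_of_ne_zero hn0
  set L := Real.logb 2 n with hLdef
  let B : ℕ → ℕ := fun p =>
    n / p ^ n.factorization p * (2 ^ n.factorization p * p ^ (n.factorization p ^ 2 / 4))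
  have hcount : Nat.card (Subgroup R) ≤ ∏ p ∈ n.primeFactors, B p :=
    (card_subgroups_le_prod R).trans <| Finset.prod_le_prod' fun p hp =>
      card_isPGroup_subgroups_le (Nat.prime_of_mem_primeFactors hp)
  have hprime : ∀ p ∈ n.primeFactors, p.Prime := fun p => Nat.prime_of_mem_primeFactors
  have hpos : ∀ p ∈ n.primeFactors, (p : ℝ) ≠ 0 := fun p hp =>
    by exact_mod_cast (hprime p hp).ne_zero
  let b : ℕ → ℝ := fun p => ((n.factorization p - 1 : ℕ) : ℝ)
  have hb : ∀ p ∈ n.primeFactors, (n.factorization p : ℝ) = b p + 1 := fun p hp => by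
    have : 1 ≤ n.factorization p := (hprime p hp).factorization_pos_of_dvd hn0
      (Nat.dvd_of_mem_primeFactors hp)
    simp only [b]
    rw [Nat.cast_sub this]
    simp
  have hL : L = ∑ p ∈ n.primeFactors, (b p + 1) * Real.logb 2 p := by
    have hfac : (n : ℝ) = ∏ p ∈ n.primeFactors, (p : ℝ) ^ n.factorization p := by
      conv_lhs => rw [← Nat.prod_factorization_pow_eq_self hn0]
      rw [Finsupp.prod, Nat.support_factorization]
      push_cast
      rfl
    rw [hLdef, hfac, Real.logb_prod _ _ fun p hp => pow_ne_zero _ (hpos p hp)]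
    exact Finset.sum_congr rfl fun p hp => by rw [Real.logb_pow, hb p hp]
  have hBcast : ∀ p ∈ n.primeFactors, (B p : ℝ) =
      n / (p : ℝ) ^ n.factorization p *
        (2 ^ n.factorization p * (p : ℝ) ^ (n.factorization p ^ 2 / 4)) := fun p hp => by
    simp only [B]
    rw [Nat.cast_mul, Nat.cast_div (Nat.ordProj_dvd n p)
      (by exact_mod_cast pow_ne_zero _ (hpos p hp))]
    push_cast
    rfl
  have hB0 : ∀ p ∈ n.primeFactors, (B p : ℝ) ≠ 0 := fun p hp => by
    rw [hBcast p hp]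
    have := hpos p hp
    positivity
  have hBlog : ∀ p ∈ n.primeFactors, Real.logb 2 (B p) ≤
      L - (b p + 1) * Real.logb 2 p + (b p + 1) + b p * (b p + 3) / 4 * Real.logb 2 p := by
    intro p hp
    have hp0 := hpos p hp
    have hl : 0 ≤ Real.logb 2 p := Real.logb_nonneg (by norm_num)
      (by exact_mod_cast (hprime p hp).one_le)
    have hexp : ((n.factorization p ^ 2 / 4 : ℕ) : ℝ) ≤ b p * (b p + 3) / 4 := by
      obtain ⟨c, hc⟩ : ∃ c, n.factorization p = c + 1 := Nat.exists_eq_succ_of_ne_zero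
        ((hprime p hp).factorization_pos_of_dvd hn0 (Nat.dvd_of_mem_primeFactors hp)).ne'
      have hbc : b p = c := by simp [b, hc]
      have : (c + 1) ^ 2 / 4 * 4 ≤ c * (c + 3) := by
        cases c with
        | zero => simp
        | succ c => exact (Nat.div_mul_le_self _ _).trans (by nlinarith)
      have : (((c + 1) ^ 2 / 4 : ℕ) : ℝ) * 4 ≤ c * (c + 3) := by exact_mod_cast this
      rw [hbc, hc]
      linarith
    rw [hBcast p hp, Real.logb_mul (by positivity) (by positivity),
      Real.logb_div hnR.ne' (by positivity), Real.logb_mul (by positivity) (by positivity),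
      Real.logb_pow, Real.logb_pow, Real.logb_pow, Real.logb_self_eq_one (by norm_num), hb p hp]
    have := mul_le_mul_of_nonneg_right hexp hl
    linarith
  have hlog : Real.logb 2 (Nat.card (Subgroup R)) ≤ L ^ 2 / 4 + 1.5315 * L + 2.5 := by
    refine le_trans ?_ (sum_logb_bound hprime b (fun p => Nat.cast_nonneg _) hL)
    refine le_trans ?_ (Finset.sum_le_sum hBlog)
    rw [← Real.logb_prod _ _ hB0]
    refine Real.logb_le_logb_of_le (by norm_num) (by exact_mod_cast Nat.card_pos) ?_
    exact_mod_cast hcount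
  have hnL : (n : ℝ) = 2 ^ L := (Real.rpow_logb (by norm_num) (by norm_num) hnR).symm
  have hconst : (2 : ℝ) ^ (2.5 : ℝ) ≤ 7.3722 := by
    rw [show (2.5 : ℝ) = 5 * (1 / 2) by norm_num, Real.rpow_mul (by norm_num),
      ← Real.sqrt_eq_rpow, Real.sqrt_le_left (by norm_num)]
    norm_num
  calc (Nat.card (Subgroup R) : ℝ)
      ≤ 2 ^ (L ^ 2 / 4 + 1.5315 * L + 2.5) :=
        (Real.logb_le_iff_le_rpow (by norm_num) (by exact_mod_cast Nat.card_pos)).1 hlog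
    _ = 2 ^ (2.5 : ℝ) * (n : ℝ) ^ (L / 4 + 1.5315) := by
        rw [hnL, ← Real.rpow_mul (by norm_num), ← Real.rpow_add (by norm_num)]
        congr 1
        ring
    _ ≤ 7.3722 * (n : ℝ) ^ (L / 4 + 1.5315) := by gcongr
end
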